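/- The direct product ∏_{n=1011}^{2020} Part(n)^{10^{127}}, i.e., the 10^{127}-th direct power of Part(1011) × Part(1012) × … × Part(2020), is a four-generated lattice. -/

import Mathlib

/-- A lattice is *four-generated* if it has a four-element subset `X` such that the
smallest sublattice containing `X` (the closure of `X` under binary meets and joins)
is the whole lattice. -/
def FourGenerated (L : Type*) [Lattice L] : Prop :=
  ∃ X : Finset L, X.card = 4 ∧ latticeClosure (X : Set L) = Set.univ

namespace PartitionLattice

/-- The equivalence relation on `Fin n` identifying points with equal labels. -/
def ofLabel (n : ℕ) (g : ℕ → ℕ) : Setoid (Fin n) := Setoid.ker fun x => g x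

/-- The equivalence relation on `Fin n` whose only nontrivial pair is `{u, v}`; it is `⊥` when
`u` or `v` is not below `n`. -/
def pair (n u v : ℕ) : Setoid (Fin n) := ofLabel n fun x => if x = v then u else x

/-- Points of equal parity. -/
def parity (n : ℕ) : Setoid (Fin n) := ofLabel n (· % 2)

/-- The blocks are `{0, 1}`, `{2, 3}`, `{4, 5}`, … -/
def evenSteps (n : ℕ) : Setoid (Fin n) := ofLabel n (· / 2)

/-- The blocks are `{0}`, `{1, 2}`, `{3, 4}`, … -/
def oddSteps (n : ℕ) : Setoid (Fin n) := ofLabel n fun x => (x + 1) / 2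

/-- The label of the fourth generator: it identifies `0` with `1`, `3` with `4`, and the point
`10 + 2 * i` with `6` or `8` according to the `i`-th bit of `c`. -/
def codeLabel (c x : ℕ) : ℕ :=
  if x = 1 then 0 else if x = 4 then 3 else
  if x % 2 = 0 ∧ 10 ≤ x then (if c.testBit ((x - 10) / 2) then 6 else 8) else x

/-- The fourth generator, depending on a code `c`. -/
def coded (n c : ℕ) : Setoid (Fin n) := ofLabel n (codeLabel c)

variable {n : ℕ}

lemma ofLabel_iff {g : ℕ → ℕ} {x y : Fin n} : ofLabel n g x y ↔ g x = g y := Iff.rfl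

lemma pair_iff {u v : ℕ} {x y : Fin n} :
    pair n u v x y ↔ (x : ℕ) = y ∨ ((x : ℕ) = u ∧ (y : ℕ) = v) ∨ ((x : ℕ) = v ∧ (y : ℕ) = u) := by
  rw [pair, ofLabel_iff]
  grind

lemma parity_iff {x y : Fin n} : parity n x y ↔ (x : ℕ) % 2 = y % 2 := Iff.rfl

lemma evenSteps_iff {x y : Fin n} : evenSteps n x y ↔ (x : ℕ) / 2 = y / 2 := Iff.rfl

lemma oddSteps_iff {x y : Fin n} : oddSteps n x y ↔ ((x : ℕ) + 1) / 2 = (y + 1) / 2 := Iff.rfl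

lemma coded_iff {c : ℕ} {x y : Fin n} : coded n c x y ↔ codeLabel c x = codeLabel c y := Iff.rfl

lemma inf_iff {r s : Setoid (Fin n)} {x y : Fin n} : (r ⊓ s) x y ↔ r x y ∧ s x y := Iff.rfl

lemma pair_comm (u v : ℕ) : pair n u v = pair n v u := by
  ext x y
  rw [pair_iff, pair_iff]
  tauto

lemma pair_le {u v : ℕ} {r : Setoid (Fin n)}
    (h : ∀ x y : Fin n, (x : ℕ) = u → (y : ℕ) = v → r x y) :
    pair n u v ≤ r := by
  intro x y hxy
  rcases pair_iff.1 hxy with e | ⟨hx, hy⟩ | ⟨hx, hy⟩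
  · exact Fin.ext e ▸ r.refl' x
  · exact h x y hx hy
  · exact r.symm' (h y x hy hx)

lemma sup_imp {r s : Setoid (Fin n)} (j : ℕ → ℕ) (hr : ∀ x y, r x y → j x = j y)
    (hs : ∀ x y, s x y → j x = j y) {x y : Fin n} (h : (r ⊔ s) x y) : j x = j y :=
  (sup_le hr hs : r ⊔ s ≤ ofLabel n j) h

lemma sup_left {r s : Setoid (Fin n)} {x y : Fin n} (h : r x y) : (r ⊔ s) x y :=
  (le_sup_left : r ≤ r ⊔ s) h

lemma sup_right {r s : Setoid (Fin n)} {x y : Fin n} (h : s x y) : (r ⊔ s) x y :=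
  (le_sup_right : s ≤ r ⊔ s) h

lemma evenSteps_inf_coded (c : ℕ) : evenSteps n ⊓ coded n c = pair n 0 1 := by
  ext x y
  rw [inf_iff, evenSteps_iff, coded_iff, pair_iff]
  unfold codeLabel
  grind

lemma oddSteps_inf_coded (c : ℕ) : oddSteps n ⊓ coded n c = pair n 3 4 := by
  ext x y
  rw [inf_iff, oddSteps_iff, coded_iff, pair_iff]
  unfold codeLabel
  grind

/-- Meeting a triangle with one of its sides. -/
lemma pair_sup_pair_inf_pair {u w v : ℕ} (hw : w < n) :
    (pair n u w ⊔ pair n w v) ⊓ pair n u v = pair n u v := by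
  refine inf_eq_right.2 (pair_le fun x y hx hy => ?_)
  exact Setoid.trans' _ (sup_left (y := ⟨w, hw⟩) (pair_iff.2 (by simp [hx])))
    (sup_right (pair_iff.2 (by simp [hy])))

/-- The fourth side of a quadrilateral with diagonal `{u, v}`. -/
lemma pair_sup_pair_inf_pair_sup_pair {u v w z : ℕ} (hw : v < n → w < n) (hz : v < n → z < n)
    (hwz : w ≠ z) (huv : u ≠ v) (hwv : w ≠ v) (hzv : z ≠ v) (huw : u ≠ w) (huz : u ≠ z) :
    (pair n u w ⊔ pair n w v) ⊓ (pair n u z ⊔ pair n z v) = pair n u v := by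
  apply le_antisymm
  · rintro x y ⟨h₁, h₂⟩
    have h₁ := sup_imp (fun t => if t = w ∨ t = v then u else t)
      (by simp only [pair_iff]; grind) (by simp only [pair_iff]; grind) h₁
    have h₂ := sup_imp (fun t => if t = z ∨ t = v then u else t)
      (by simp only [pair_iff]; grind) (by simp only [pair_iff]; grind) h₂
    rw [pair_iff]
    grind
  · refine pair_le fun x y hx hy => ⟨?_, ?_⟩
    · exact Setoid.trans' _ (sup_left (y := ⟨w, hw (hy ▸ y.2)⟩) (pair_iff.2 (by simp [hx])))
        (sup_right (pair_iff.2 (by simp [hy])))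
    · exact Setoid.trans' _ (sup_left (y := ⟨z, hz (hy ▸ y.2)⟩) (pair_iff.2 (by simp [hx])))
        (sup_right (pair_iff.2 (by simp [hy])))

lemma pair_zero_sup_oddSteps_inf_parity {m : ℕ} (hm : m % 2 = 1) :
    (pair n 0 m ⊔ oddSteps n) ⊓ parity n = pair n 0 (m + 1) := by
  apply le_antisymm
  · rintro x y ⟨h₁, h₂⟩
    have h₁ := sup_imp (fun t => if t = m ∨ t = m + 1 then 0 else (t + 1) / 2)
      (by simp only [pair_iff]; grind) (by simp only [oddSteps_iff]; grind) h₁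
    rw [parity_iff] at h₂
    rw [pair_iff]
    grind
  · refine pair_le fun x y hx hy => ⟨?_, parity_iff.2 (by omega)⟩
    exact Setoid.trans' _ (sup_left (y := ⟨m, by omega⟩) (pair_iff.2 (by simp [hx])))
      (sup_right (oddSteps_iff.2 (by simp only; omega)))

lemma pair_one_succ {m : ℕ} (hm : m % 2 = 0) (hm4 : 4 ≤ m) :
    ((pair n 0 m ⊔ evenSteps n) ⊓ parity n) ⊓
      (((pair n 2 m ⊔ evenSteps n) ⊓ parity n) ⊔ pair n 1 3) = pair n 1 (m + 1) := by
  have key : ∀ u, u % 2 = 0 → ∀ x y : Fin n, (x : ℕ) = u + 1 → (y : ℕ) = m + 1 →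
      ((pair n u m ⊔ evenSteps n) ⊓ parity n) x y := by
    refine fun u hu x y hx hy => ⟨?_, parity_iff.2 (by omega)⟩
    have hxu : evenSteps n x ⟨u, by omega⟩ := evenSteps_iff.2 (by simp only; omega)
    have hum : pair n u m ⟨u, by omega⟩ ⟨m, by omega⟩ := pair_iff.2 (by simp)
    have hmy : evenSteps n ⟨m, by omega⟩ y := evenSteps_iff.2 (by simp only; omega)
    exact Setoid.trans' _ (sup_right hxu) (Setoid.trans' _ (sup_left hum) (sup_right hmy))
  apply le_antisymm
  · rintro x y ⟨⟨h₁, h₂⟩, h₃⟩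
    have h₁ := sup_imp (fun t => if t = m ∨ t = m + 1 then 0 else t / 2)
      (by simp only [pair_iff]; grind) (by simp only [evenSteps_iff]; grind) h₁
    have h₃ := sup_imp (fun t => if t = m then 2 else if t = 3 ∨ t = m + 1 then 1 else t)
      (by
        rintro a b ⟨h, hp⟩
        have h := sup_imp (fun t => if t = m ∨ t = m + 1 then 1 else t / 2)
          (by simp only [pair_iff]; grind) (by simp only [evenSteps_iff]; grind) h
        rw [parity_iff] at hp
        grind)
      (by simp only [pair_iff]; grind) h₃
    rw [parity_iff] at h₂
    rw [pair_iff]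
    grind
  · refine pair_le fun x y hx hy => ⟨key 0 rfl x y hx hy, ?_⟩
    exact Setoid.trans' _ (sup_right (y := ⟨3, by omega⟩) (pair_iff.2 (by simp [hx])))
      (sup_left (key 2 rfl _ y rfl hy))

lemma pair_zero_two_sup_evenSteps_inf_oddSteps (hn : 10 ≤ n) :
    (pair n 0 2 ⊔ evenSteps n) ⊓ oddSteps n = pair n 1 2 := by
  apply le_antisymm
  · rintro x y ⟨h₁, h₂⟩
    have h₁ := sup_imp (fun t => if t < 4 then 0 else t / 2)
      (by simp only [pair_iff]; grind) (by simp only [evenSteps_iff]; grind) h₁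
    rw [oddSteps_iff] at h₂
    rw [pair_iff]
    split_ifs at h₁ <;> omega
  · refine pair_le fun x y hx hy => ⟨?_, oddSteps_iff.2 (by omega)⟩
    exact Setoid.trans' _ (sup_right (y := ⟨0, by omega⟩) (evenSteps_iff.2 (by simp [hx])))
      (sup_left (pair_iff.2 (by simp [hy])))

lemma pair_one_three (hn : 10 ≤ n) :
    ((pair n 0 2 ⊔ evenSteps n) ⊓ parity n) ⊓
      ((((pair n 3 4 ⊔ evenSteps n) ⊓ parity n) ⊔ oddSteps n) ⊓ parity n) = pair n 1 3 := by
  apply le_antisymm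
  · rintro x y ⟨⟨h₁, h₂⟩, h₃, -⟩
    have h₁ := sup_imp (fun t => if t < 4 then 0 else t / 2)
      (by simp only [pair_iff]; grind) (by simp only [evenSteps_iff]; grind) h₁
    have h₃ := sup_imp (fun t => if 1 ≤ t ∧ t ≤ 6 then 1 else (t + 1) / 2)
      (by
        rintro a b ⟨h, hp⟩
        have h := sup_imp (fun t => if 2 ≤ t ∧ t ≤ 5 then 1 else (t + 4) / 2)
          (by simp only [pair_iff]; grind) (by simp only [evenSteps_iff]; grind) h
        rw [parity_iff] at hp
        grind)
      (by simp only [oddSteps_iff]; grind) h₃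
    rw [parity_iff] at h₂
    rw [pair_iff]
    grind
  · refine pair_le fun x y hx hy => ?_
    have hp : parity n x y := parity_iff.2 (by omega)
    refine ⟨⟨?_, hp⟩, ?_, hp⟩
    · have h₁ : evenSteps n x ⟨0, by omega⟩ := evenSteps_iff.2 (by simp [hx])
      have h₂ : pair n 0 2 ⟨0, by omega⟩ ⟨2, by omega⟩ := pair_iff.2 (by simp)
      have h₃ : evenSteps n ⟨2, by omega⟩ y := evenSteps_iff.2 (by simp [hy])
      exact Setoid.trans' _ (sup_right h₁) (Setoid.trans' _ (sup_left h₂) (sup_right h₃))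
    · have h₁ : oddSteps n x ⟨2, by omega⟩ := oddSteps_iff.2 (by simp [hx])
      have h₂ : evenSteps n ⟨2, by omega⟩ ⟨3, by omega⟩ := evenSteps_iff.2 (by simp)
      have h₃ : pair n 3 4 ⟨3, by omega⟩ ⟨4, by omega⟩ := pair_iff.2 (by simp)
      have h₄ : oddSteps n ⟨4, by omega⟩ y := oddSteps_iff.2 (by simp [hy])
      exact Setoid.trans' _ (sup_right h₁) (Setoid.trans' _
        (sup_left ⟨Setoid.trans' _ (sup_right h₂) (sup_left h₃), parity_iff.2 (by simp)⟩)
          (sup_right h₄))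

/-- Recovering a step along the path from two sides of a triangle. -/
lemma step_inf_pair_sup_pair {u m : ℕ} (hu : u < m) (g : ℕ → ℕ)
    (hg : g m = g (m + 1)) (hgu : g u ≠ g m) :
    ofLabel n g ⊓ (pair n u m ⊔ pair n u (m + 1)) = pair n m (m + 1) := by
  apply le_antisymm
  · rintro x y ⟨h₁, h₂⟩
    have h₂ := sup_imp (fun t => if t = m ∨ t = m + 1 then u else t)
      (by simp only [pair_iff]; grind) (by simp only [pair_iff]; grind) h₂
    rw [ofLabel_iff] at h₁
    rw [pair_iff]
    grind
  · refine pair_le fun x y hx hy => ⟨ofLabel_iff.2 (by rw [hx, hy, hg]), ?_⟩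
    exact Setoid.trans' _ (sup_left (y := ⟨u, by omega⟩) (pair_iff.2 (by simp [hx])))
      (sup_right (pair_iff.2 (by simp [hy])))

lemma pair_inf_coded {c i x y : ℕ} (hx : x = 10 + 2 * i) (hy : y = if c.testBit i then 6 else 8) :
    pair n x y ⊓ coded n c = pair n x y := by
  refine inf_eq_left.2 (pair_le fun a b ha hb => coded_iff.2 ?_)
  have hi : (10 + 2 * i - 10) / 2 = i := by omega
  rw [ha, hb, hx, hy]
  unfold codeLabel
  rw [hi]
  grind

lemma pair_inf_coded_eq_bot {c d i x y : ℕ} (hx : x = 10 + 2 * i)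
    (hy : y = if c.testBit i then 6 else 8) (hcd : c.testBit i ≠ d.testBit i) :
    pair n x y ⊓ coded n d = ⊥ := by
  have hi : (10 + 2 * i - 10) / 2 = i := by omega
  have hd : codeLabel d x ≠ codeLabel d y := by
    rw [hx, hy]
    unfold codeLabel
    rw [hi]
    grind
  refine eq_bot_iff.2 fun a b ⟨h₁, h₂⟩ => ?_
  rw [coded_iff] at h₂
  rcases pair_iff.1 h₁ with h | ⟨ha, hb⟩ | ⟨ha, hb⟩
  · exact Fin.ext h
  · exact absurd (ha ▸ hb ▸ h₂) hd
  · exact absurd (ha ▸ hb ▸ h₂.symm) hd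

lemma pair_inf_pair_eq_bot {u v w : ℕ} (hvw : v ≠ w) :
    pair n u v ⊓ pair n u w = ⊥ := by
  refine eq_bot_iff.2 fun a b ⟨h₁, h₂⟩ => Fin.ext ?_
  rw [pair_iff] at h₁ h₂
  omega

lemma bot_sup_pair_inf_pair {u w v : ℕ} (huw : u ≠ w) :
    ((⊥ : Setoid (Fin n)) ⊔ pair n w v) ⊓ pair n u v = ⊥ := by
  rw [bot_sup_eq, pair_comm w v, pair_comm u v]
  exact pair_inf_pair_eq_bot huw.symm

section Product

variable {P : Type*} {N : P → ℕ} {S : Sublattice (∀ p, Setoid (Fin (N p)))}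

/-- All pairs are generated by the first three generators and the two meets with the fourth one. -/
lemma pair_mem (hN : ∀ p, 10 ≤ N p) {code : P → ℕ} (hpar : (fun p => parity (N p)) ∈ S)
    (heven : (fun p => evenSteps (N p)) ∈ S) (hodd : (fun p => oddSteps (N p)) ∈ S)
    (hcode : (fun p => coded (N p) (code p)) ∈ S) {u v : ℕ} (huv : u ≠ v) :
    (fun p => pair (N p) u v) ∈ S := by
  have h01 : (fun p => pair (N p) 0 1) ∈ S := by
    convert S.inf_mem heven hcode using 1
    exact funext fun p => (evenSteps_inf_coded _).symm
  have h34 : (fun p => pair (N p) 3 4) ∈ S := by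
    convert S.inf_mem hodd hcode using 1
    exact funext fun p => (oddSteps_inf_coded _).symm
  have h02 : (fun p => pair (N p) 0 2) ∈ S := by
    convert S.inf_mem (S.sup_mem h01 hodd) hpar using 1
    exact funext fun p => (pair_zero_sup_oddSteps_inf_parity rfl).symm
  have h12 : (fun p => pair (N p) 1 2) ∈ S := by
    convert S.inf_mem (S.sup_mem h02 heven) hodd using 1
    exact funext fun p => (pair_zero_two_sup_evenSteps_inf_oddSteps (hN p)).symm
  have h13 : (fun p => pair (N p) 1 3) ∈ S := by
    convert S.inf_mem (S.inf_mem (S.sup_mem h02 heven) hpar)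
      (S.inf_mem (S.sup_mem (S.inf_mem (S.sup_mem h34 heven) hpar) hodd) hpar) using 1
    exact funext fun p => (pair_one_three (hN p)).symm
  have step : ∀ m u₀, u₀ < m → (∀ u v, u ≤ m → v ≤ m → u ≠ v → (fun p => pair (N p) u v) ∈ S) →
      (fun p => pair (N p) u₀ (m + 1)) ∈ S → (fun p => pair (N p) m (m + 1)) ∈ S →
      ∀ u v, u ≤ m + 1 → v ≤ m + 1 → u ≠ v → (fun p => pair (N p) u v) ∈ S := by
    intro m u₀ hu₀ ih h₀ hm
    have last : ∀ u ≤ m, (fun p => pair (N p) u (m + 1)) ∈ S := by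
      intro u hu
      rcases eq_or_ne u u₀ with rfl | hne
      · exact h₀
      rcases eq_or_ne u m with rfl | hne'
      · exact hm
      convert S.inf_mem (S.sup_mem (ih u u₀ hu hu₀.le hne) h₀)
        (S.sup_mem (ih u m hu le_rfl hne') hm) using 1
      exact funext fun p => (pair_sup_pair_inf_pair_sup_pair (by omega) (by omega) (by omega)
        (by omega) (by omega) (by omega) hne hne').symm
    intro u v hu hv huv
    rcases hu.eq_or_lt with rfl | hu'
    · simp only [pair_comm (m + 1) v]
      exact last v (by omega)
    · rcases hv.eq_or_lt with rfl | hv'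
      · exact last u (by omega)
      · exact ih u v (by omega) (by omega) huv
  have all : ∀ m, 2 ≤ m → ∀ u v, u ≤ m → v ≤ m → u ≠ v → (fun p => pair (N p) u v) ∈ S := by
    intro m hm
    induction m, hm using Nat.le_induction with
    | base =>
      refine step 1 0 one_pos (fun u v hu hv huv => ?_) h02 h12
      obtain ⟨rfl, rfl⟩ | ⟨rfl, rfl⟩ : u = 0 ∧ v = 1 ∨ u = 1 ∧ v = 0 := by omega
      · exact h01
      · simpa only [pair_comm 1 0] using h01
    | succ m hm ih =>
      rcases Nat.mod_two_eq_zero_or_one m with h | h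
      · have h1 : (fun p => pair (N p) 1 (m + 1)) ∈ S := by
          rcases hm.eq_or_lt with rfl | hm'
          · exact h13
          convert S.inf_mem (S.inf_mem (S.sup_mem (ih 0 m (by omega) le_rfl (by omega)) heven) hpar)
            (S.sup_mem (S.inf_mem (S.sup_mem (ih 2 m hm le_rfl hm'.ne) heven) hpar) h13) using 1
          exact funext fun p => (pair_one_succ h (by omega)).symm
        refine step m 1 hm ih h1 ?_
        convert S.inf_mem heven (S.sup_mem (ih 1 m (by omega) le_rfl (by omega)) h1) using 1
        exact funext fun p => (step_inf_pair_sup_pair hm (· / 2) (by grind) (by grind)).symm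
      · have h0 : (fun p => pair (N p) 0 (m + 1)) ∈ S := by
          convert S.inf_mem (S.sup_mem (ih 0 m (by omega) le_rfl (by omega)) hodd) hpar using 1
          exact funext fun p => (pair_zero_sup_oddSteps_inf_parity h).symm
        refine step m 0 (by omega) ih h0 ?_
        convert S.inf_mem hodd (S.sup_mem (ih 0 m (by omega) le_rfl (by omega)) h0) using 1
        exact funext fun p => (step_inf_pair_sup_pair (by omega) (fun x => (x + 1) / 2) (by grind)
          (by grind)).symm
  exact all (u + v + 2) (by omega) u v (by omega) (by omega) huv

lemma exists_mem_pair_and_bot {p q : P} (hpair : ∀ u v, u ≠ v → (fun p => pair (N p) u v) ∈ S)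
    {x y : ℕ} (hx : x < N p) (hy : y < N p) (hxy : x ≠ y)
    (h : ∃ F ∈ S, F p = pair (N p) x y ∧ F q = ⊥) {u v : ℕ} (hu : u < N p) (huv : u ≠ v) :
    ∃ F ∈ S, F p = pair (N p) u v ∧ F q = ⊥ := by
  have turn : ∀ {a b c : ℕ}, b < N p → a ≠ b → a ≠ c →
      (∃ F ∈ S, F p = pair (N p) a b ∧ F q = ⊥) → ∃ F ∈ S, F p = pair (N p) a c ∧ F q = ⊥ := by
    rintro a b c hb hab hac ⟨F, hF, hp, hq⟩
    rcases eq_or_ne b c with rfl | hbc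
    · exact ⟨F, hF, hp, hq⟩
    refine ⟨_, S.inf_mem (S.sup_mem hF (hpair b c hbc)) (hpair a c hac), ?_, ?_⟩
    · rw [Pi.inf_apply, Pi.sup_apply, hp, pair_sup_pair_inf_pair hb]
    · rw [Pi.inf_apply, Pi.sup_apply, hq, bot_sup_pair_inf_pair hab]
  have flip : ∀ {a b : ℕ}, (∃ F ∈ S, F p = pair (N p) a b ∧ F q = ⊥) →
      ∃ F ∈ S, F p = pair (N p) b a ∧ F q = ⊥ := by
    intro a b h
    rwa [pair_comm b a]
  rcases eq_or_ne x u with rfl | hxu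
  · exact turn hy hxy huv h
  · exact turn hx hxu.symm huv (flip (turn hy hxy hxu h))

open Classical in
lemma single_mem [Finite P] (hpair : ∀ u v, u ≠ v → (fun p => pair (N p) u v) ∈ S)
    (hsep : ∀ p q, p ≠ q → ∀ u v, u < N p → u ≠ v → ∃ F ∈ S, F p = pair (N p) u v ∧ F q = ⊥)
    (p : P) {u v : ℕ} (hu : u < N p) (huv : u ≠ v) :
    Function.update (⊥ : ∀ p, Setoid (Fin (N p))) p (pair (N p) u v) ∈ S := by
  have key : ∀ s : Finset P, p ∉ s → ∃ F ∈ S, F p = pair (N p) u v ∧ ∀ q ∈ s, F q = ⊥ := by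
    intro s
    induction s using Finset.induction_on with
    | empty => exact fun _ => ⟨_, hpair u v huv, rfl, by simp⟩
    | insert q s _ ih =>
      intro hp
      rw [Finset.mem_insert, not_or] at hp
      obtain ⟨F, hF, hFp, hFs⟩ := ih hp.2
      obtain ⟨G, hG, hGp, hGq⟩ := hsep p q hp.1 u v hu huv
      refine ⟨F ⊓ G, S.inf_mem hF hG, by rw [Pi.inf_apply, hFp, hGp, inf_idem], fun r hr => ?_⟩
      rcases Finset.mem_insert.1 hr with rfl | hr
      · rw [Pi.inf_apply, hGq, inf_bot_eq]
      · rw [Pi.inf_apply, hFs r hr, bot_inf_eq]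
  have := Fintype.ofFinite P
  obtain ⟨F, hF, hFp, hFq⟩ := key (Finset.univ.erase p) (by simp)
  convert hF using 1
  funext q
  rcases eq_or_ne q p with rfl | hqp
  · rw [Function.update_self, hFp]
  · rw [Function.update_of_ne hqp, hFq q (by simp [hqp]), Pi.bot_apply]

open Classical in
lemma eq_top_of_single_mem [Finite P] (hbot : ⊥ ∈ S)
    (h : ∀ p u v, u < N p → u ≠ v →
      Function.update (⊥ : ∀ p, Setoid (Fin (N p))) p (pair (N p) u v) ∈ S) : S = ⊤ := by
  have := Fintype.ofFinite P
  refine eq_top_iff.2 fun F _ => ?_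
  let f : (Σ p, Fin (N p) × Fin (N p)) → ∀ p, Setoid (Fin (N p)) := fun t =>
    if t.2.1 ≠ t.2.2 ∧ F t.1 t.2.1 t.2.2 then
      Function.update ⊥ t.1 (pair (N t.1) t.2.1 t.2.2) else ⊥
  have f_of_rel : ∀ t, t.2.1 ≠ t.2.2 ∧ F t.1 t.2.1 t.2.2 →
      f t = Function.update ⊥ t.1 (pair (N t.1) t.2.1 t.2.2) := fun _ ht => if_pos ht
  have f_of_not_rel : ∀ t, ¬(t.2.1 ≠ t.2.2 ∧ F t.1 t.2.1 t.2.2) → f t = ⊥ :=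
    fun _ ht => if_neg ht
  have hf : F = Finset.univ.sup f := by
    apply le_antisymm
    · intro p x y hxy
      rcases eq_or_ne x y with rfl | hne
      · exact Setoid.refl' _ x
      · have hle : f ⟨p, x, y⟩ ≤ Finset.univ.sup f := Finset.le_sup (Finset.mem_univ _)
        refine hle p ?_
        rw [f_of_rel _ ⟨hne, hxy⟩, Function.update_self]
        exact pair_iff.2 (by simp)
    · refine Finset.sup_le fun t _ => ?_
      by_cases ht : t.2.1 ≠ t.2.2 ∧ F t.1 t.2.1 t.2.2
      · rw [f_of_rel t ht]
        refine update_le_iff.2 ⟨pair_le fun x y hx hy => ?_, fun _ _ => bot_le⟩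
        rw [Fin.ext hx, Fin.ext hy]
        exact ht.2
      · exact (f_of_not_rel t ht).trans_le bot_le
  rw [hf]
  refine Finset.sup_induction hbot (fun _ ha _ hb => S.sup_mem ha hb) fun t _ => ?_
  by_cases ht : t.2.1 ≠ t.2.2 ∧ F t.1 t.2.1 t.2.2
  · rw [f_of_rel t ht]
    exact h _ _ _ t.2.1.2 (Fin.val_ne_of_ne ht.1)
  · rwa [f_of_not_rel t ht]

/-- The four generators generate the whole product when the codes are pairwise distinct. -/
lemma eq_top_of_generators_mem [Finite P] {b : ℕ} (hN : ∀ p, 2 * b + 10 ≤ N p) {code : P → ℕ}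
    (hinj : Function.Injective code) (hlt : ∀ p, code p < 2 ^ b)
    (hpar : (fun p => parity (N p)) ∈ S) (heven : (fun p => evenSteps (N p)) ∈ S)
    (hodd : (fun p => oddSteps (N p)) ∈ S) (hcode : (fun p => coded (N p) (code p)) ∈ S) :
    S = ⊤ := by
  have hpair : ∀ u v, u ≠ v → (fun p => pair (N p) u v) ∈ S := fun u v huv =>
    pair_mem (fun p => by have := hN p; omega) hpar heven hodd hcode huv
  refine eq_top_of_single_mem ?_ fun p u v hu huv => single_mem hpair ?_ p hu huv
  · convert S.inf_mem (hpair 0 1 (by omega)) (hpair 0 2 (by omega)) using 1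
    exact funext fun p => (pair_inf_pair_eq_bot (by omega)).symm
  · intro p q hpq u v hu huv
    obtain ⟨i, hi⟩ : ∃ i, (code p).testBit i ≠ (code q).testBit i := by
      by_contra! h
      exact hpq (hinj (Nat.eq_of_testBit_eq h))
    have hib : i < b := by
      by_contra! h
      have hle : 2 ^ b ≤ 2 ^ i := Nat.pow_le_pow_right two_pos h
      rw [Nat.testBit_lt_two_pow ((hlt p).trans_le hle),
        Nat.testBit_lt_two_pow ((hlt q).trans_le hle)] at hi
      exact hi rfl
    have hNp := hN p
    have hy : (if (code p).testBit i then 6 else 8) ≤ 8 := by split_ifs <;> omega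
    have hne : 10 + 2 * i ≠ if (code p).testBit i then 6 else 8 := by omega
    refine exists_mem_pair_and_bot hpair (x := 10 + 2 * i)
      (y := if (code p).testBit i then 6 else 8) (by omega) (by omega) hne
      ⟨_, S.inf_mem (hpair _ _ hne) hcode, ?_, ?_⟩ hu huv
    · exact pair_inf_coded rfl rfl
    · exact pair_inf_coded_eq_bot rfl rfl hi

end Product

end PartitionLattice

lemma FourGenerated.of_orderIso {L M : Type*} [Lattice L] [Lattice M] (e : L ≃o M)
    (h : FourGenerated L) : FourGenerated M := by
  obtain ⟨X, hX, hgen⟩ := h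
  refine ⟨X.map e.toEquiv.toEmbedding, by rw [Finset.card_map, hX],
    Set.eq_univ_of_forall fun m => ?_⟩
  have hsub : latticeClosure (X : Set L) ⊆
      e ⁻¹' latticeClosure ((X.map e.toEquiv.toEmbedding : Finset M) : Set M) := by
    refine latticeClosure_min (fun x hx => subset_latticeClosure ?_) ⟨?_, ?_⟩
    · exact Finset.mem_coe.2 (Finset.mem_map_of_mem _ hx)
    · intro x hx y hy
      rw [Set.mem_preimage, map_sup]
      exact isSublattice_latticeClosure.supClosed hx hy
    · intro x hx y hy
      rw [Set.mem_preimage, map_inf]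
      exact isSublattice_latticeClosure.infClosed hx hy
  have := hsub (hgen ▸ Set.mem_univ (e.symm m))
  rwa [Set.mem_preimage, e.apply_symm_apply] at this

open PartitionLattice in
/-- A nonempty product of at most `2 ^ b` partition lattices, each on at least `2 * b + 10` points,
is four-generated. -/
theorem fourGenerated_pi_setoid_fin {P : Type*} [Finite P] [Nonempty P] {N : P → ℕ} {b : ℕ}
    (hP : Nat.card P ≤ 2 ^ b) (hN : ∀ p, 2 * b + 10 ≤ N p) :
    FourGenerated (∀ p, Setoid (Fin (N p))) := by
  classical
  let code : P → ℕ := fun p => Finite.equivFin P p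
  have hinj : Function.Injective code := Fin.val_injective.comp (Finite.equivFin P).injective
  have hlt : ∀ p, code p < 2 ^ b := fun p => (Finite.equivFin P p).2.trans_le hP
  let X : Finset (∀ p, Setoid (Fin (N p))) :=
    {fun p => parity (N p), fun p => evenSteps (N p), fun p => oddSteps (N p),
      fun p => coded (N p) (code p)}
  refine ⟨X, ?_, ?_⟩
  · obtain ⟨p⟩ := ‹Nonempty P›
    have hNp := hN p
    have distinct : ∀ {F G : ∀ p, Setoid (Fin (N p))} (i j : ℕ) (hi : i < N p) (hj : j < N p),
        F p ⟨i, hi⟩ ⟨j, hj⟩ → ¬ G p ⟨i, hi⟩ ⟨j, hj⟩ → F ≠ G := by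
      rintro F G i j hi hj h₁ h₂ rfl
      exact h₂ h₁
    have h₁ : (fun p => parity (N p)) ≠ fun p => evenSteps (N p) :=
      distinct 0 2 (by omega) (by omega) (by simp [parity_iff]) (by simp [evenSteps_iff])
    have h₂ : (fun p => parity (N p)) ≠ fun p => oddSteps (N p) :=
      distinct 0 2 (by omega) (by omega) (by simp [parity_iff]) (by simp [oddSteps_iff])
    have h₃ : (fun p => parity (N p)) ≠ fun p => coded (N p) (code p) :=
      distinct 0 2 (by omega) (by omega) (by simp [parity_iff]) (by simp [coded_iff, codeLabel])
    have h₄ : (fun p => evenSteps (N p)) ≠ fun p => oddSteps (N p) :=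
      distinct 2 3 (by omega) (by omega) (by simp [evenSteps_iff]) (by simp [oddSteps_iff])
    have h₅ : (fun p => evenSteps (N p)) ≠ fun p => coded (N p) (code p) :=
      distinct 2 3 (by omega) (by omega) (by simp [evenSteps_iff]) (by simp [coded_iff, codeLabel])
    have h₆ : (fun p => oddSteps (N p)) ≠ fun p => coded (N p) (code p) :=
      distinct 1 2 (by omega) (by omega) (by simp [oddSteps_iff]) (by simp [coded_iff, codeLabel])
    simp only [X]
    rw [Finset.card_insert_of_notMem, Finset.card_insert_of_notMem, Finset.card_pair h₆] <;>
      simp only [Finset.mem_insert, Finset.mem_singleton, not_or] <;> tauto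
  · let S : Sublattice (∀ p, Setoid (Fin (N p))) :=
      ⟨latticeClosure X, isSublattice_latticeClosure.supClosed,
        isSublattice_latticeClosure.infClosed⟩
    have mem : ∀ F ∈ X, F ∈ S := fun F hF => subset_latticeClosure (Finset.mem_coe.2 hF)
    have hS : S = ⊤ := eq_top_of_generators_mem hN hinj hlt (mem _ (by simp [X]))
      (mem _ (by simp [X])) (mem _ (by simp [X])) (mem _ (by simp [X]))
    exact congrArg (SetLike.coe) hS

lemma mul_ten_pow_127_le_two_pow_432 : 1010 * 10 ^ 127 ≤ 2 ^ 432 := by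
  rw [show 432 = 216 + 216 from rfl, pow_add]
  norm_num

/-- The `10^127`-th direct power of `Part(1011) × Part(1012) × … × Part(2020)`, i.e.
the direct product `∏_{n=1011}^{2020} Part(n)^(10^127)` of partition lattices
(`1010` factors, the `i`-th being `Setoid (Fin (1011 + i))`), with componentwise meets
and joins, is four-generated. -/
theorem part_1011_to_2020_power_fourGenerated :
    FourGenerated (∀ i : Fin 1010, Fin (10 ^ 127) → Setoid (Fin (1011 + i.val))) := by
  have : NeZero (10 ^ 127) := ⟨by positivity⟩
  have h : FourGenerated (∀ p : Σ _ : Fin 1010, Fin (10 ^ 127), Setoid (Fin (1011 + p.1.val))) :=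
    fourGenerated_pi_setoid_fin (b := 432) (by
      rw [Nat.card_sigma]
      simpa only [Nat.card_eq_fintype_card, Fintype.card_fin, Finset.sum_const, Finset.card_univ,
        smul_eq_mul] using mul_ten_pow_127_le_two_pow_432) fun p => by omega
  exact h.of_orderIso
    { Equiv.piCurry fun (i : Fin 1010) (_ : Fin (10 ^ 127)) => Setoid (Fin (1011 + i.val)) with
      map_rel_iff' := by
        intro F G
        exact ⟨fun h p => (h p.1 p.2 : F p ≤ G p), fun h i k => (h ⟨i, k⟩ : F ⟨i, k⟩ ≤ G ⟨i, k⟩)⟩ }
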